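/- arXiv:1011.1027 — 2 statements merged into one kernel-verified Lean document; each statement's English description precedes it below -/
import Mathlib

section
/- Let T be an orthogonal transformation of ℝ^{p,q} such that for every vector x with B(x,x) ≠ 0, the vector T(x) − x is nonzero and isotropic. Then det T = 1, the image of T − I equals the kernel of T − I, and this common subspace U is a null subspace (B vanishes identically on U × U) of dimension (p+q)/2. -/
/-- The standard bilinear form of signature `(p, q)` on `ℝ^(p+q)`:
`B x y = ∑_{i < p} x i * y i - ∑_{p ≤ i < p+q} x i * y i`. -/
noncomputable def Bpq (p q : ℕ) : LinearMap.BilinForm ℝ (Fin (p + q) → ℝ) :=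
  LinearMap.mk₂ ℝ
    (fun x y => ∑ i : Fin (p + q), (if i.val < p then (1 : ℝ) else -1) * (x i * y i))
    (fun x x' y => by simp [add_mul, mul_add, Finset.sum_add_distrib])
    (fun c x y => by simp [Finset.mul_sum]; congr 1; funext i; ring_nf)
    (fun x y y' => by simp [add_mul, mul_add, Finset.sum_add_distrib])
    (fun c x y => by simp [Finset.mul_sum]; congr 1; funext i; ring_nf)

theorem Bpq_app (p q : ℕ) (x y : Fin (p + q) → ℝ) : Bpq p q x y =
    ∑ i : Fin (p + q), (if i.val < p then (1 : ℝ) else -1) * (x i * y i) := rfl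

theorem Bpq_symm (p q : ℕ) (x y : Fin (p + q) → ℝ) : Bpq p q x y = Bpq p q y x := by
  simp only [Bpq_app, mul_comm (x _)]

theorem Bpq_single (p q : ℕ) (x : Fin (p + q) → ℝ) (i : Fin (p + q)) :
    Bpq p q x (Pi.single i 1) = (if i.val < p then (1 : ℝ) else -1) * x i := by
  rw [Bpq_app, Finset.sum_eq_single i]
  · simp
  · intro j _ hj
    simp [hj]
  · simp

theorem Bpq_sep (p q : ℕ) (x : Fin (p + q) → ℝ) (h : ∀ y, Bpq p q x y = 0) : x = 0 := by
  funext i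
  have := h (Pi.single i 1)
  rw [Bpq_single] at this
  split_ifs at this <;> simpa using this

theorem Bpq_nondeg (p q : ℕ) : (Bpq p q).Nondegenerate :=
  ⟨fun x h => Bpq_sep p q x h, fun x h => Bpq_sep p q x fun y => by rw [Bpq_symm]; exact h y⟩

/-- if `T` is an orthogonal transformation of `ℝ^{p,q}` such that
`T x - x` is nonzero and isotropic for every nonisotropic `x`, then `det T = 1`,
`Im (T - I) = Ker (T - I)`, and this common subspace `U` is a null subspace of
dimension `(p + q) / 2`. -/
theorem stmt_4 (p q : ℕ) (T : (Fin (p + q) → ℝ) →ₗ[ℝ] (Fin (p + q) → ℝ))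
    (horth : ∀ x y : Fin (p + q) → ℝ, Bpq p q (T x) (T y) = Bpq p q x y)
    (hiso : ∀ x : Fin (p + q) → ℝ, Bpq p q x x ≠ 0 →
      T x - x ≠ 0 ∧ Bpq p q (T x - x) (T x - x) = 0) :
    LinearMap.det T = 1 ∧
    LinearMap.range (T - LinearMap.id) = LinearMap.ker (T - LinearMap.id) ∧
    (∀ u ∈ LinearMap.ker (T - LinearMap.id), ∀ v ∈ LinearMap.ker (T - LinearMap.id),
      Bpq p q u v = 0) ∧
    Module.finrank ℝ (LinearMap.ker (T - LinearMap.id)) = (p + q) / 2 := by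
  set N := T - LinearMap.id with hN
  have hNa : ∀ x, N x = T x - x := fun x => rfl
  have hTa : ∀ x, T x = N x + x := fun x => by rw [hNa]; abel
  have hQ : ∀ x, Bpq p q (N x) (N x) = 0 := by
    intro x
    by_cases hx : Bpq p q x x = 0
    swap
    · exact (hiso x hx).2
    by_cases hx0 : x = 0
    · simp [hx0]
    obtain ⟨i, hi⟩ := Function.ne_iff.1 hx0
    obtain ⟨y, hy⟩ : ∃ y, Bpq p q y y ≠ 0 := by
      refine ⟨Pi.single i 1, ?_⟩
      rw [Bpq_single]
      split_ifs <;> simp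
    have key : ∀ t : ℝ, t ≠ 0 → 2 * Bpq p q x y + t * Bpq p q y y ≠ 0 →
        Bpq p q (N x) (N x) + 2 * t * Bpq p q (N x) (N y) = 0 := by
      intro t ht h
      have h1 : Bpq p q (x + t • y) (x + t • y) =
          t * (2 * Bpq p q x y + t * Bpq p q y y) := by
        simp only [map_add, LinearMap.add_apply, map_smul, LinearMap.smul_apply, smul_eq_mul, hx,
          Bpq_symm p q y x]
        ring
      have h2 := (hiso (x + t • y) (by rw [h1]; exact mul_ne_zero ht h)).2
      have h3 := (hiso y hy).2
      rw [← hNa] at h2 h3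
      simp only [map_add, LinearMap.add_apply, map_smul, LinearMap.smul_apply, smul_eq_mul, h3,
          Bpq_symm p q (N y) (N x)] at h2
      linarith
    have k1 := key 1 (by norm_num)
    have k2 := key 2 (by norm_num)
    have k3 := key 3 (by norm_num)
    by_cases c1 : 2 * Bpq p q x y + 1 * Bpq p q y y = 0
    · have := k2 (fun h => hy (by linarith))
      have := k3 (fun h => hy (by linarith))
      linarith
    · have := k1 c1
      by_cases c2 : 2 * Bpq p q x y + 2 * Bpq p q y y = 0
      · have := k3 (fun h => hy (by linarith))
        linarith
      · have := k2 c2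
        linarith
  have hNN : ∀ x y, Bpq p q (N x) (N y) = 0 := by
    intro x y
    have := hQ (x + y)
    simp only [map_add, LinearMap.add_apply, hQ, Bpq_symm p q (N y) (N x)] at this
    linarith
  have hskew : ∀ x y, Bpq p q (N x) y = - Bpq p q x (N y) := by
    intro x y
    have := horth x y
    simp only [hTa, map_add, LinearMap.add_apply, hNN] at this
    linarith
  have hN2 : ∀ x, N (N x) = 0 := fun x => Bpq_sep p q _ fun y => by
    rw [hskew, hNN, neg_zero]
  have hker : ∀ u ∈ LinearMap.ker N, Bpq p q u u = 0 := by
    intro u hu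
    by_contra h
    exact (hiso u h).1 hu
  have hker2 : ∀ u ∈ LinearMap.ker N, ∀ v ∈ LinearMap.ker N, Bpq p q u v = 0 := by
    intro u hu v hv
    have := hker _ (add_mem hu hv)
    simp only [map_add, LinearMap.add_apply, hker u hu, hker v hv, Bpq_symm p q v u] at this
    linarith
  have hle : LinearMap.range N ≤ LinearMap.ker N := by
    rintro _ ⟨x, rfl⟩
    exact hN2 x
  have hle2 : LinearMap.ker N ≤ (Bpq p q).orthogonal (LinearMap.ker N) :=
    fun v hv u hu => hker2 u hu v hv
  have d1 := Submodule.finrank_mono hle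
  have d2 := Submodule.finrank_mono hle2
  rw [LinearMap.BilinForm.finrank_orthogonal (Bpq_nondeg p q)] at d2
  have d3 := LinearMap.finrank_range_add_finrank_ker N
  have d4 : Module.finrank ℝ (Fin (p + q) → ℝ) = p + q := by simp
  rw [d4] at d2 d3
  refine ⟨?_, Submodule.eq_of_le_of_finrank_le hle (by omega), hker2, by omega⟩
  have hnil : IsNilpotent (-N : Module.End ℝ (Fin (p + q) → ℝ)) :=
    ⟨2, LinearMap.ext fun x => by simp [pow_two, hN2]⟩
  have h1 := LinearMap.eval_charpoly (-N) 1
  rw [IsNilpotent.charpoly_eq_X_pow_finrank hnil] at h1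
  have h2 : (algebraMap ℝ (Module.End ℝ (Fin (p + q) → ℝ)) 1 - -N) = T := by
    apply LinearMap.ext
    intro x
    simp [hNa]
  rw [h2] at h1
  simpa using h1.symm
end

section
/- Let A be a nontrivial associative unital real algebra and f : ℝ^{p+q} → A an injective linear map such that f(v)·f(v) = B(v,v)·1 for every vector v and such that A is generated as an ℝ-algebra by the image of f. Let n = p+q be odd and suppose the product f(e_1)·f(e_2)⋯f(e_n) of the images of the standard basis vectors is NOT a real scalar multiple of 1. Then the dimension of A as a real vector space equals 2^n. -/
section CliffAux

variable {n : ℕ} {A : Type*} [Ring A] [Algebra ℝ A]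

/-- equality up to a nonzero real scalar -/
def CEq (x y : A) : Prop := ∃ c : ℝ, c ≠ 0 ∧ x = c • y

theorem CEq.rfl' (x : A) : CEq x x := ⟨1, one_ne_zero, by simp⟩

theorem CEq.trans' {x y z : A} (h : CEq x y) (h' : CEq y z) : CEq x z := by
  obtain ⟨c, hc, rfl⟩ := h
  obtain ⟨d, hd, rfl⟩ := h'
  exact ⟨c * d, mul_ne_zero hc hd, by rw [mul_smul]⟩

theorem CEq.mulL (a : A) {x y : A} (h : CEq x y) : CEq (a * x) (a * y) := by
  obtain ⟨c, hc, rfl⟩ := h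
  exact ⟨c, hc, by simp⟩

/-- ordered monomial -/
def mono (g : Fin n → A) (l : List (Fin n)) : A := (l.map g).prod

theorem mono_perm (g : Fin n → A) (hanti : ∀ i j, i ≠ j → g i * g j = - (g j * g i))
    {l l' : List (Fin n)} (h : l.Perm l') : CEq (mono g l) (mono g l') := by
  induction h with
  | nil => exact CEq.rfl' _
  | cons x _ ih => simpa [mono] using ih.mulL (g x)
  | swap x y l =>
    by_cases hxy : y = x
    · subst hxy; exact CEq.rfl' _
    · refine ⟨-1, by norm_num, ?_⟩
      simp only [mono, List.map_cons, List.prod_cons, ← mul_assoc]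
      rw [hanti y x hxy]; simp
  | trans _ _ h1 h2 => exact h1.trans' h2

/-- monomial of a finset -/
noncomputable def fmono (g : Fin n → A) (S : Finset (Fin n)) : A := mono g S.toList

theorem gen_mul_fmono (g : Fin n → A) (hanti : ∀ i j, i ≠ j → g i * g j = - (g j * g i))
    (ε : Fin n → ℝ) (hε : ∀ i, ε i * ε i = 1) (hg : ∀ i, g i * g i = algebraMap ℝ A (ε i))
    (i : Fin n) (S : Finset (Fin n)) : CEq (g i * fmono g S) (fmono g (symmDiff {i} S)) := by
  by_cases hi : i ∈ S
  · have h1 : symmDiff {i} S = S.erase i := by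
      ext j; simp [Finset.mem_symmDiff]; grind
    rw [h1]
    have h2 : S.toList.Perm (i :: (S.erase i).toList) := by
      have := Finset.toList_insert (Finset.notMem_erase i S)
      rwa [Finset.insert_erase hi] at this
    refine ((mono_perm g hanti h2).mulL (g i)).trans' ⟨ε i, ?_, ?_⟩
    · intro h; have := hε i; simp [h] at this
    · simp only [mono, fmono, List.map_cons, List.prod_cons, ← mul_assoc]
      rw [hg, Algebra.smul_def]
  · have h1 : symmDiff {i} S = insert i S := by
      ext j; simp [Finset.mem_symmDiff]; grind
    rw [h1]
    have := mono_perm g hanti (Finset.toList_insert hi).symm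
    simpa [mono, fmono] using this

theorem mono_mul_fmono (g : Fin n → A) (hanti : ∀ i j, i ≠ j → g i * g j = - (g j * g i))
    (ε : Fin n → ℝ) (hε : ∀ i, ε i * ε i = 1) (hg : ∀ i, g i * g i = algebraMap ℝ A (ε i))
    (l : List (Fin n)) (hl : l.Nodup) (S : Finset (Fin n)) :
    CEq (mono g l * fmono g S) (fmono g (symmDiff l.toFinset S)) := by
  induction l with
  | nil => 
    have h0 : symmDiff (List.toFinset []) S = S := by
      ext j; simp [Finset.mem_symmDiff]
    rw [h0]
    simpa [mono] using CEq.rfl' (fmono g S)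
  | cons i l ih =>
    rw [List.nodup_cons] at hl
    have h := ((ih hl.2).mulL (g i)).trans' (gen_mul_fmono g hanti ε hε hg i _)
    have h1 : symmDiff {i} (symmDiff l.toFinset S) = symmDiff (i :: l).toFinset S := by
      ext j
      have := hl.1
      simp only [Finset.mem_symmDiff, List.mem_toFinset, List.mem_cons, Finset.mem_singleton]
      grind
    rw [h1] at h
    simpa [mono, mul_assoc] using h

theorem fmono_mul_fmono (g : Fin n → A) (hanti : ∀ i j, i ≠ j → g i * g j = - (g j * g i))
    (ε : Fin n → ℝ) (hε : ∀ i, ε i * ε i = 1) (hg : ∀ i, g i * g i = algebraMap ℝ A (ε i))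
    (T S : Finset (Fin n)) :
    CEq (fmono g T * fmono g S) (fmono g (symmDiff T S)) := by
  have := mono_mul_fmono g hanti ε hε hg T.toList T.nodup_toList S
  rw [Finset.toList_toFinset] at this
  exact this

/-- commutation sign -/
def chi (S : Finset (Fin n)) (i : Fin n) : ℝ := (-1) ^ S.card * (if i ∈ S then -1 else 1)

theorem gen_mono_comm (g : Fin n → A) (hanti : ∀ i j, i ≠ j → g i * g j = - (g j * g i))
    (i : Fin n) (l : List (Fin n)) (hl : l.Nodup) :
    g i * mono g l = ((-1) ^ l.length * (if i ∈ l then -1 else 1) : ℝ) • (mono g l * g i) := by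
  induction l with
  | nil => simp [mono]
  | cons j l ih =>
    rw [List.nodup_cons] at hl
    have h := ih hl.2
    have e : mono g (j :: l) = g j * mono g l := by simp [mono]
    rw [e]
    by_cases hij : i = j
    · subst hij
      rw [mul_assoc (g i), h]
      have h2 : mono g l * g i = ((-1) ^ l.length * (if i ∈ l then -1 else 1) : ℝ) •
          (g i * mono g l) := by
        rw [h, smul_smul]
        simp [hl.1, ← mul_pow]
      simp [hl.1, pow_succ]
    · rw [← mul_assoc, hanti i j hij, neg_mul, mul_assoc, h]
      by_cases hil : i ∈ l <;> simp [hij, hil, pow_succ, mul_assoc]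

theorem gen_fmono_comm (g : Fin n → A) (hanti : ∀ i j, i ≠ j → g i * g j = - (g j * g i))
    (i : Fin n) (S : Finset (Fin n)) :
    g i * fmono g S = chi S i • (fmono g S * g i) := by
  have := gen_mono_comm g hanti i S.toList S.nodup_toList
  simp only [Finset.length_toList, Finset.mem_toList] at this
  exact this

theorem chi_sq (S : Finset (Fin n)) (i : Fin n) : chi S i * chi S i = 1 := by
  unfold chi
  rcases neg_one_pow_eq_or ℝ S.card with h | h <;> rw [h] <;> split_ifs <;> norm_num

theorem exists_chi (S T : Finset (Fin n)) (h1 : T ≠ S) (h2 : T ≠ Sᶜ) :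
    ∃ i, 1 + chi S i * chi T i = 0 := by
  by_contra! hc
  have key : ∀ i, chi S i = chi T i := by
    intro i
    have := hc i
    unfold chi at *
    rcases neg_one_pow_eq_or ℝ S.card with h | h <;>
    rcases neg_one_pow_eq_or ℝ T.card with h' | h' <;>
    rw [h, h'] at this ⊢ <;> clear h h' hc <;> split_ifs at this ⊢ <;>
    first | (norm_num; done) | (norm_num at this; done)
  unfold chi at key
  by_cases hp : (-1 : ℝ) ^ S.card = (-1) ^ T.card
  · apply h1
    ext i
    have := key i
    rw [hp] at this
    rcases neg_one_pow_eq_or ℝ T.card with h' | h' <;> rw [h'] at this <;>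
    split_ifs at this <;> first | tauto | (norm_num at this)
  · apply h2
    ext i
    have := key i
    rcases neg_one_pow_eq_or ℝ S.card with h | h <;>
    rcases neg_one_pow_eq_or ℝ T.card with h' | h' <;> rw [h, h'] at this hp <;>
    first | exact absurd rfl hp | skip
    all_goals
      simp only [Finset.mem_compl]
      split_ifs at this <;> first | tauto | (norm_num at this)

/-- averaging operator -/
noncomputable def avg (g : Fin n → A) (ε : Fin n → ℝ) (S : Finset (Fin n)) (i : Fin n) :
    A →ₗ[ℝ] A :=
  LinearMap.id + (chi S i * ε i) • (LinearMap.mulLeft ℝ (g i) ∘ₗ LinearMap.mulRight ℝ (g i))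

theorem avg_fmono (g : Fin n → A) (hanti : ∀ i j, i ≠ j → g i * g j = - (g j * g i))
    (ε : Fin n → ℝ) (hε : ∀ i, ε i * ε i = 1) (hg : ∀ i, g i * g i = algebraMap ℝ A (ε i))
    (S T : Finset (Fin n)) (i : Fin n) :
    avg g ε S i (fmono g T) = (1 + chi S i * chi T i) • fmono g T := by
  simp only [avg, LinearMap.add_apply, LinearMap.id_apply, LinearMap.smul_apply,
    LinearMap.comp_apply, LinearMap.mulLeft_apply, LinearMap.mulRight_apply]
  rw [← mul_assoc, gen_fmono_comm g hanti, smul_mul_assoc, mul_assoc, hg,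
    ← Algebra.commutes, ← Algebra.smul_def, smul_smul, smul_smul, add_smul, one_smul]
  congr 2
  linear_combination (chi S i * chi T i) * hε i

theorem avgs_fmono (g : Fin n → A) (hanti : ∀ i j, i ≠ j → g i * g j = - (g j * g i))
    (ε : Fin n → ℝ) (hε : ∀ i, ε i * ε i = 1) (hg : ∀ i, g i * g i = algebraMap ℝ A (ε i))
    (S T : Finset (Fin n)) (l : List (Fin n)) :
    (l.map (fun i => (avg g ε S i : Module.End ℝ A))).prod (fmono g T) =
      (l.map (fun i => 1 + chi S i * chi T i)).prod • fmono g T := by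
  induction l with
  | nil => simp
  | cons i l ih =>
    simp only [List.map_cons, List.prod_cons, Module.End.mul_apply, ih, map_smul]
    rw [avg_fmono g hanti ε hε hg, smul_smul, mul_comm]

theorem fmono_indep (g : Fin n → A) (hanti : ∀ i j, i ≠ j → g i * g j = - (g j * g i))
    (ε : Fin n → ℝ) (hε : ∀ i, ε i * ε i = 1) (hg : ∀ i, g i * g i = algebraMap ℝ A (ε i))
    (hA : (1 : A) ≠ 0) (hu : ¬ ∃ r : ℝ, fmono g Finset.univ = algebraMap ℝ A r) :
    LinearIndependent ℝ (fmono g) := by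
  rw [Fintype.linearIndependent_iff]
  intro c hc S
  by_contra hS
  have hne : S ≠ Sᶜ := by
    intro h
    rcases isEmpty_or_nonempty (Fin n) with h0 | ⟨⟨i⟩⟩
    · apply hu
      exact ⟨1, by simp [fmono, mono]⟩
    · have : i ∈ S ↔ i ∈ Sᶜ := by rw [← h]
      simp at this
  have h1 := congrArg
    ((List.finRange n).map (fun i => (avg g ε S i : Module.End ℝ A))).prod hc
  simp only [map_sum, map_smul, map_zero, avgs_fmono g hanti ε hε hg] at h1
  rw [Fintype.sum_eq_add S Sᶜ hne] at h1
  · have h2 := congrArg (fun x => fmono g S * x) h1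
    obtain ⟨d, hd, hd'⟩ := fmono_mul_fmono g hanti ε hε hg S S
    obtain ⟨d2, hd2, hd2'⟩ := fmono_mul_fmono g hanti ε hε hg S Sᶜ
    have e1 : symmDiff S S = ∅ := by simp
    have e2 : symmDiff S Sᶜ = Finset.univ := by
      simp
    have e3 : fmono g ∅ = 1 := by simp [fmono, mono]
    rw [e1, e3] at hd'
    rw [e2] at hd2'
    simp only [mul_add, mul_smul_comm, hd', hd2', smul_smul, mul_zero] at h2
    have hk : ((List.finRange n).map (fun i => 1 + chi S i * chi S i)).prod ≠ 0 := by
      apply List.prod_ne_zero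
      simp [chi_sq]
      norm_num
    set a := c S * ((List.finRange n).map (fun i => 1 + chi S i * chi S i)).prod * d with ha
    have ha0 : a ≠ 0 := mul_ne_zero (mul_ne_zero hS hk) hd
    generalize c Sᶜ * ((List.finRange n).map (fun i => 1 + chi S i * chi Sᶜ i)).prod * d2 = b
      at h2
    by_cases hb : b = 0
    · rw [hb, zero_smul, add_zero] at h2
      exact (smul_ne_zero ha0 hA) h2
    · apply hu
      refine ⟨- (b⁻¹ * a), ?_⟩
      rw [Algebra.algebraMap_eq_smul_one, neg_smul, mul_smul, eq_neg_of_add_eq_zero_left h2,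
        smul_neg, neg_neg, smul_smul, inv_mul_cancel₀ hb, one_smul]
  · rintro T ⟨hT1, hT2⟩
    obtain ⟨i, hi⟩ := exists_chi S T hT1 hT2
    have : ((List.finRange n).map (fun i => 1 + chi S i * chi T i)).prod = 0 :=
      List.prod_eq_zero (List.mem_map.2 ⟨i, List.mem_finRange i, hi⟩)
    rw [this, zero_smul, smul_zero]

theorem fmono_span (g : Fin n → A) (hanti : ∀ i j, i ≠ j → g i * g j = - (g j * g i))
    (ε : Fin n → ℝ) (hε : ∀ i, ε i * ε i = 1) (hg : ∀ i, g i * g i = algebraMap ℝ A (ε i))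
    (hgen : Algebra.adjoin ℝ (Set.range g) = ⊤) :
    Submodule.span ℝ (Set.range (fmono g)) = ⊤ := by
  set V := Submodule.span ℝ (Set.range (fmono g)) with hV
  have hone : (1 : A) ∈ V := Submodule.subset_span ⟨∅, by simp [fmono, mono]⟩
  have hmul : ∀ x y : A, y ∈ V → x * y ∈ V := by
    intro x
    have hx : x ∈ Algebra.adjoin ℝ (Set.range g) := by rw [hgen]; trivial
    induction hx using Algebra.adjoin_induction with
    | mem x hx =>
      obtain ⟨i, rfl⟩ := hx
      intro y hy
      induction hy using Submodule.span_induction with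
      | mem y hy =>
        obtain ⟨S, rfl⟩ := hy
        obtain ⟨c, _, h⟩ := gen_mul_fmono g hanti ε hε hg i S
        rw [h]
        exact V.smul_mem _ (Submodule.subset_span ⟨_, rfl⟩)
      | zero => simp
      | add a b _ _ ha hb => rw [mul_add]; exact V.add_mem ha hb
      | smul r a _ ha => rw [mul_smul_comm]; exact V.smul_mem _ ha
    | algebraMap r => intro y hy; rw [← Algebra.smul_def]; exact V.smul_mem _ hy
    | add a b _ _ ha hb => intro y hy; rw [add_mul]; exact V.add_mem (ha y hy) (hb y hy)
    | mul a b _ _ ha hb => intro y hy; rw [mul_assoc]; exact ha _ (hb y hy)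
  rw [eq_top_iff]
  intro x _
  simpa using hmul x 1 hone

end CliffAux

/-- if `A` is a nontrivial associative unital real algebra generated by
the image of an injective linear map `f : ℝ^(p+q) → A` with `f v * f v = B v v • 1`,
`n = p + q` is odd, and the product `f e_1 ⋯ f e_n` over the standard basis is not a
real scalar multiple of `1`, then `dim_ℝ A = 2 ^ n`. -/
theorem stmt_15 (p q : ℕ) (A : Type*) [Ring A] [Algebra ℝ A] (hA : (1 : A) ≠ 0)
    (f : (Fin (p + q) → ℝ) →ₗ[ℝ] A) (hinj : Function.Injective ⇑f)
    (hsq : ∀ v : Fin (p + q) → ℝ, f v * f v = algebraMap ℝ A (Bpq p q v v))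
    (hgen : Algebra.adjoin ℝ (Set.range ⇑f) = ⊤)
    (hodd : Odd (p + q))
    (hprod : ¬ ∃ lam : ℝ,
      (List.ofFn fun i : Fin (p + q) => f (Pi.single i 1)).prod = algebraMap ℝ A lam) :
    Module.finrank ℝ A = 2 ^ (p + q) := by
  let g : Fin (p + q) → A := fun i => f (Pi.single i 1)
  let ε : Fin (p + q) → ℝ := fun i => if i.val < p then 1 else -1
  have hε : ∀ i, ε i * ε i = 1 := by
    intro i; simp only [ε]; split_ifs <;> norm_num
  have hB : ∀ x y, Bpq p q x y =
      ∑ i : Fin (p + q), (if i.val < p then (1 : ℝ) else -1) * (x i * y i) := fun _ _ => rfl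
  have hg : ∀ i, g i * g i = algebraMap ℝ A (ε i) := by
    intro i
    simp only [g, hsq, ε]
    congr 1
    rw [hB, Finset.sum_eq_single i]
    · simp
    · intro j _ hj; simp [hj]
    · simp
  have hanti : ∀ i j, i ≠ j → g i * g j = - (g j * g i) := by
    intro i j hij
    have h := hsq (Pi.single i 1 + Pi.single j 1)
    have h0 : Bpq p q (Pi.single i 1) (Pi.single j 1) = 0 := by
      rw [hB]
      apply Finset.sum_eq_zero
      intro k _
      by_cases hk : k = i
      · subst hk; simp [hij]
      · simp [hk]
    have h0' : Bpq p q (Pi.single j 1) (Pi.single i 1) = 0 := by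
      rw [← h0, hB, hB]
      simp only [mul_comm]
    simp only [map_add, LinearMap.add_apply, h0, h0', add_mul, mul_add, hsq, add_zero,
      zero_add, map_zero] at h
    have h3 : g i * g j + g j * g i = 0 := by
      simp only [g]
      rw [← sub_eq_zero] at h
      rw [← h]
      abel
    exact eq_neg_of_add_eq_zero_left h3
  have hgen' : Algebra.adjoin ℝ (Set.range g) = ⊤ := by
    rw [eq_top_iff, ← hgen]
    apply Algebra.adjoin_le
    rintro _ ⟨v, rfl⟩
    have : f v = ∑ i, v i • g i := by
      conv_lhs => rw [pi_eq_sum_univ' v]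
      simp [g, Pi.single_apply, Pi.single, Function.update]
    rw [this]
    exact Subalgebra.sum_mem _ fun i _ =>
      Subalgebra.smul_mem _ (Algebra.subset_adjoin (Set.mem_range_self i)) _
  have hu : ¬ ∃ r : ℝ, fmono g Finset.univ = algebraMap ℝ A r := by
    rintro ⟨r, hr⟩
    have hperm : (List.finRange (p + q)).Perm (Finset.univ : Finset (Fin (p + q))).toList := by
      rw [List.perm_ext_iff_of_nodup (List.nodup_finRange _) (Finset.nodup_toList _)]
      simp
    obtain ⟨c, _, h⟩ := mono_perm g hanti hperm
    apply hprod
    refine ⟨c * r, ?_⟩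
    rw [List.ofFn_eq_map]
    change mono g (List.finRange (p + q)) = _
    rw [h]
    change c • fmono g Finset.univ = _
    rw [hr, map_mul, Algebra.smul_def]
  have b := Module.Basis.mk (fmono_indep g hanti ε hε hg hA hu)
    (fmono_span g hanti ε hε hg hgen').ge
  rw [Module.finrank_eq_card_basis b]
  simp
end
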